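/- Let N ≥ 1 be an integer, σ > 0, h > 0, λ > 0. Consider the function F(a) = max{ a²σ², (1/N)·a²σ²/(2 a h λ − 1) } on the set of a with 2 a h λ > 1. Then F attains its minimum at a* = (N+1)/(2Nλh), and the minimum value is F(a*) = ((N+1)/(2N))² · (σ²/λ²) · (1/h)². -/

import Mathlib

/-- On `0 < x ≤ t ≤ 1`, the function `x ↦ (1 + x) ^ 2 / x` is at least its value at `t`. -/
lemma one_add_sq_mul_le {t x : ℝ} (hx : 0 ≤ x) (hxt : x ≤ t) (ht : t ≤ 1) :
    (1 + t) ^ 2 * x ≤ t * (1 + x) ^ 2 := by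
  have hprod : 0 ≤ (t - x) * (1 - t * x) :=
    mul_nonneg (sub_nonneg.2 hxt) (by nlinarith)
  linarith

/-- For an integer `N ≥ 1` and `σ > 0`, `h > 0`, `λ > 0`, the function
`F(a) = max { a²σ², (1/N)·a²σ²/(2 a h λ − 1) }` on `{a | 2 a h λ > 1}` attains
its minimum at `a* = (N+1)/(2Nλh)`, with minimum value
`((N+1)/(2N))²·(σ²/λ²)·(1/h)²`. -/
theorem optimal_covariance_norm (N : ℕ) (hN : 1 ≤ N) (σ h lam : ℝ)
    (hσ : 0 < σ) (hh : 0 < h) (hlam : 0 < lam)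
    (F : ℝ → ℝ)
    (hF : F = fun a => max (a ^ 2 * σ ^ 2)
        ((1 / N) * (a ^ 2 * σ ^ 2 / (2 * a * h * lam - 1)))) :
    2 * ((N + 1) / (2 * N * lam * h)) * h * lam > 1 ∧
    (∀ a : ℝ, 2 * a * h * lam > 1 → F ((N + 1) / (2 * N * lam * h)) ≤ F a) ∧
    F ((N + 1) / (2 * N * lam * h)) =
      ((N + 1) / (2 * N)) ^ 2 * (σ ^ 2 / lam ^ 2) * (1 / h) ^ 2 := by
  have hN' : (1 : ℝ) ≤ N := by exact_mod_cast hN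
  have hN0 : (0 : ℝ) < N := by linarith
  have hA : 2 * (((N : ℝ) + 1) / (2 * N * lam * h)) * h * lam = 1 + 1 / N := by
    field_simp
  have hApos : 0 < ((N : ℝ) + 1) / (2 * N * lam * h) := by positivity
  have hval : F ((N + 1) / (2 * N * lam * h)) =
      (((N : ℝ) + 1) / (2 * N * lam * h)) ^ 2 * σ ^ 2 := by
    rw [hF]
    beta_reduce
    rw [hA, add_sub_cancel_left, one_div_mul_eq_div, div_div,
      one_div_mul_cancel hN0.ne', div_one, max_self]
  refine ⟨?_, fun a ha => ?_, ?_⟩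
  · rw [hA]
    have : (0 : ℝ) < 1 / N := by positivity
    linarith
  · rw [hval, hF]
    generalize ((N : ℝ) + 1) / (2 * N * lam * h) = A at hA hApos
    rcases le_total A a with hle | hle
    · exact le_max_of_le_left (by gcongr)
    · refine le_max_of_le_right ?_
      have hx : 0 < 2 * a * h * lam - 1 := by linarith
      have hxt : 2 * a * h * lam - 1 ≤ 1 / N := by
        have : 2 * a * h * lam ≤ 2 * A * h * lam := by gcongr
        linarith
      have key := one_add_sq_mul_le hx.le hxt ((div_le_one hN0).2 hN')
      rw [← hA, add_sub_cancel] at key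
      have hscaled : A ^ 2 * (2 * a * h * lam - 1) ≤ 1 / N * a ^ 2 := by
        refine le_of_mul_le_mul_left ?_ (show 0 < (2 * h * lam) ^ 2 by positivity)
        linarith
      rw [← mul_div_assoc, le_div_iff₀ hx]
      linarith [mul_le_mul_of_nonneg_right hscaled (sq_nonneg σ)]
  · rw [hval]
    field_simp
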